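/- For every finite simple graph G, |nucleus(G)| + |diadem(G)| ≤ 2α(G). -/

import Mathlib

/-- `S` is an independent set in `G`: no two of its vertices are adjacent. -/
def IndepSet {V : Type*} (G : SimpleGraph V) (S : Set V) : Prop :=
  ∀ ⦃u⦄, u ∈ S → ∀ ⦃v⦄, v ∈ S → ¬G.Adj u v

/-- The independence number `α(G)`. -/
noncomputable def indNum {V : Type*} (G : SimpleGraph V) : ℕ :=
  sSup {n : ℕ | ∃ S : Set V, IndepSet G S ∧ S.ncard = n}

/-- `Ω(G)`: the family of maximum independent sets of `G`. -/
def maxIndepFam {V : Type*} (G : SimpleGraph V) : Set (Set V) :=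
  {S | IndepSet G S ∧ S.ncard = indNum G}

/-- `N(X)`: the neighborhood of a set of vertices. -/
def nbhd {V : Type*} (G : SimpleGraph V) (X : Set V) : Set V :=
  {v | ∃ x ∈ X, G.Adj v x}

/-- `N[X] = N(X) ∪ X`: the closed neighborhood of a set of vertices. -/
def closedNbhd {V : Type*} (G : SimpleGraph V) (X : Set V) : Set V :=
  nbhd G X ∪ X

/-- The difference `d(X) = |X| - |N(X)|`. -/
noncomputable def diffd {V : Type*} (G : SimpleGraph V) (X : Set V) : ℤ :=
  (X.ncard : ℤ) - ((nbhd G X).ncard : ℤ)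

/-- The critical difference `d(G) = max {d(X) : X ⊆ V(G)}`. -/
noncomputable def critDiff {V : Type*} (G : SimpleGraph V) : ℤ :=
  sSup {d : ℤ | ∃ X : Set V, diffd G X = d}

/-- `X` is a critical set if `d(X) = d(G)`. -/
def IsCritical {V : Type*} (G : SimpleGraph V) (X : Set V) : Prop :=
  diffd G X = critDiff G

/-- `MaxCritIndep(G)`: the family of critical independent sets of maximum cardinality. -/
def maxCritIndepFam {V : Type*} (G : SimpleGraph V) : Set (Set V) :=
  {S | IndepSet G S ∧ IsCritical G S ∧
    ∀ T : Set V, IndepSet G T → IsCritical G T → T.ncard ≤ S.ncard}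

/-- The critical independence number `α'(G)`. -/
noncomputable def critIndNum {V : Type*} (G : SimpleGraph V) : ℕ :=
  sSup {n : ℕ | ∃ S : Set V, IndepSet G S ∧ IsCritical G S ∧ S.ncard = n}

/-- `ker(G)`: the intersection of all critical independent sets. -/
def kerSet {V : Type*} (G : SimpleGraph V) : Set V :=
  ⋂₀ {A : Set V | IndepSet G A ∧ IsCritical G A}

/-- `nucleus(G)`: the intersection of all maximum critical independent sets. -/
def nucleus {V : Type*} (G : SimpleGraph V) : Set V :=
  ⋂₀ maxCritIndepFam G

/-- `diadem(G)`: the union of all maximum critical independent sets. -/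
def diadem {V : Type*} (G : SimpleGraph V) : Set V :=
  ⋃₀ maxCritIndepFam G

/-- `core(G)`: the intersection of all maximum independent sets. -/
def coreSet {V : Type*} (G : SimpleGraph V) : Set V :=
  ⋂₀ maxIndepFam G

/-- `corona(G)`: the union of all maximum independent sets. -/
def coronaSet {V : Type*} (G : SimpleGraph V) : Set V :=
  ⋃₀ maxIndepFam G

/-- A matching in `G`: a set of pairwise non-incident edges of `G`. -/
def IsMatchingSet {V : Type*} (G : SimpleGraph V) (M : Set (Sym2 V)) : Prop :=
  M ⊆ G.edgeSet ∧ M.Pairwise fun e f => ∀ v, v ∈ e → v ∉ f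

/-- The matching number `μ(G)`. -/
noncomputable def matchNum {V : Type*} (G : SimpleGraph V) : ℕ :=
  sSup {n : ℕ | ∃ M : Set (Sym2 V), IsMatchingSet G M ∧ M.ncard = n}

/-- `G` is a König-Egerváry graph if `α(G) + μ(G) = |V(G)|`. -/
def IsKonigEgervary {V : Type*} (G : SimpleGraph V) : Prop :=
  indNum G + matchNum G = Nat.card V

/-- `Γ` is a König-Egerváry collection: a family of independent sets with
`|⋂Γ| + |⋃Γ| = 2α(G)`. -/
def IsKECollection {V : Type*} (G : SimpleGraph V) (Γ : Set (Set V)) : Prop :=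
  (∀ S ∈ Γ, IndepSet G S) ∧ (⋂₀ Γ).ncard + (⋃₀ Γ).ncard = 2 * indNum G

theorem diffd_le_critDiff {V : Type*} [Finite V] (G : SimpleGraph V) (X : Set V) :
    diffd G X ≤ critDiff G :=
  le_csSup (Set.finite_range (diffd G)).bddAbove ⟨X, rfl⟩

theorem exists_isCritical {V : Type*} [Finite V] (G : SimpleGraph V) :
    ∃ X : Set V, IsCritical G X :=
  (Set.range_nonempty (diffd G)).csSup_mem (Set.finite_range (diffd G))

theorem IndepSet.ncard_le_indNum {V : Type*} [Finite V] {G : SimpleGraph V} {S : Set V}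
    (hS : IndepSet G S) : S.ncard ≤ indNum G := by
  refine le_csSup ⟨Nat.card V, ?_⟩ ⟨S, hS, rfl⟩
  rintro _ ⟨T, -, rfl⟩
  exact Set.ncard_le_card T

theorem IndepSet.disjoint_nbhd {V : Type*} {G : SimpleGraph V} {S : Set V}
    (hS : IndepSet G S) : Disjoint (nbhd G S) S := by
  rw [Set.disjoint_left]
  rintro v ⟨x, hx, h⟩ hv
  exact hS hv hx h

theorem indepSet_diff_nbhd {V : Type*} (G : SimpleGraph V) (X : Set V) :
    IndepSet G (X \ nbhd G X) :=
  fun _ hu v hv h => hu.2 ⟨v, hv.1, h⟩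

theorem nbhd_mono {V : Type*} (G : SimpleGraph V) {X Y : Set V} (h : X ⊆ Y) :
    nbhd G X ⊆ nbhd G Y :=
  fun _ ⟨x, hx, hvx⟩ => ⟨x, h hx, hvx⟩

theorem nbhd_diff_nbhd_subset {V : Type*} (G : SimpleGraph V) (X Y : Set V) :
    nbhd G (X \ nbhd G Y) ⊆ nbhd G X \ Y :=
  fun v ⟨x, hx, hvx⟩ => ⟨⟨x, hx.1, hvx⟩, fun hv => hx.2 ⟨v, hv, hvx.symm⟩⟩

/-- Deleting `N(Y)` from a critical set `X` does not increase the difference. -/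
theorem IsCritical.ncard_nbhd_inter_le {V : Type*} [Finite V] {G : SimpleGraph V} {X : Set V}
    (hX : IsCritical G X) (Y : Set V) :
    (nbhd G X ∩ Y).ncard ≤ (X ∩ nbhd G Y).ncard := by
  have h₁ := diffd_le_critDiff G (X \ nbhd G Y)
  have h₂ := Set.ncard_le_ncard (nbhd_diff_nbhd_subset G X Y)
  have h₃ := Set.ncard_inter_add_ncard_sdiff_eq_ncard X (nbhd G Y)
  have h₄ := Set.ncard_inter_add_ncard_sdiff_eq_ncard (nbhd G X) Y
  simp only [IsCritical, diffd] at hX h₁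
  omega

theorem IsCritical.diff_nbhd {V : Type*} [Finite V] {G : SimpleGraph V} {X : Set V}
    (hX : IsCritical G X) : IsCritical G (X \ nbhd G X) := by
  have h₁ := diffd_le_critDiff G (X \ nbhd G X)
  have h₂ := Set.ncard_le_ncard (nbhd_diff_nbhd_subset G X X)
  have h₃ := Set.ncard_inter_add_ncard_sdiff_eq_ncard X (nbhd G X)
  have h₄ := Set.ncard_inter_add_ncard_sdiff_eq_ncard (nbhd G X) X
  rw [Set.inter_comm] at h₄
  simp only [IsCritical, diffd] at hX h₁ ⊢
  omega

theorem maxCritIndepFam_nonempty {V : Type*} [Finite V] (G : SimpleGraph V) :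
    (maxCritIndepFam G).Nonempty := by
  obtain ⟨X, hX⟩ := exists_isCritical G
  obtain ⟨S, hS, hmax⟩ := Set.exists_max_image {S : Set V | IndepSet G S ∧ IsCritical G S}
    Set.ncard (Set.toFinite _) ⟨_, indepSet_diff_nbhd G X, hX.diff_nbhd⟩
  exact ⟨S, hS.1, hS.2, fun T hT hT' => hmax T ⟨hT, hT'⟩⟩

/-- Adjoining a critical set `B` to any set `A` adds at least as many vertices as neighbors. -/
theorem IsCritical.ncard_nbhd_diff_le {V : Type*} [Finite V] {G : SimpleGraph V} {B : Set V}
    (hB : IsCritical G B) (A : Set V) :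
    (nbhd G B \ nbhd G A).ncard ≤ (B \ A).ncard := by
  have h₁ := diffd_le_critDiff G (B ∩ A)
  have h₂ : (nbhd G (B ∩ A)).ncard ≤ (nbhd G B ∩ nbhd G A).ncard :=
    Set.ncard_le_ncard <| Set.subset_inter (nbhd_mono G Set.inter_subset_left)
      (nbhd_mono G Set.inter_subset_right)
  have h₃ := Set.ncard_inter_add_ncard_sdiff_eq_ncard B A
  have h₄ := Set.ncard_inter_add_ncard_sdiff_eq_ncard (nbhd G B) (nbhd G A)
  simp only [IsCritical, diffd] at hB h₁
  omega

theorem IsCritical.ncard_nbhd_diff_closedNbhd_le {V : Type*} [Finite V] {G : SimpleGraph V}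
    {A B : Set V} (hAi : IndepSet G A) (hA : IsCritical G A) (hB : IsCritical G B) :
    (nbhd G B \ closedNbhd G A).ncard ≤ (B \ closedNbhd G A).ncard := by
  have hdisj := Set.disjoint_left.1 hAi.disjoint_nbhd
  have h₁ := hB.ncard_nbhd_diff_le A
  have h₂ := hA.ncard_nbhd_inter_le B
  have h₃ := Set.ncard_inter_add_ncard_sdiff_eq_ncard (B \ A) (nbhd G A)
  have h₄ := Set.ncard_inter_add_ncard_sdiff_eq_ncard (nbhd G B \ nbhd G A) A
  have e₁ : (B \ A) ∩ nbhd G A = nbhd G A ∩ B := by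
    ext v; have := @hdisj v; simp only [Set.mem_inter_iff, Set.mem_sdiff]; tauto
  have e₂ : (nbhd G B \ nbhd G A) ∩ A = A ∩ nbhd G B := by
    ext v; have := @hdisj v; simp only [Set.mem_inter_iff, Set.mem_sdiff]; tauto
  rw [e₁, Set.sdiff_sdiff, Set.union_comm] at h₃
  rw [e₂, Set.sdiff_sdiff] at h₄
  simp only [closedNbhd]
  omega

/-- All maximum critical independent sets have the same closed neighborhood. -/
theorem closedNbhd_subset_of_mem_maxCritIndepFam {V : Type*} [Finite V] {G : SimpleGraph V}
    {A B : Set V} (hA : A ∈ maxCritIndepFam G) (hB : B ∈ maxCritIndepFam G) :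
    closedNbhd G B ⊆ closedNbhd G A := by
  obtain ⟨hAi, hAc, hAmax⟩ := hA
  obtain ⟨hBi, hBc, -⟩ := hB
  have hle := hAc.ncard_nbhd_diff_closedNbhd_le hAi hBc
  have hindep : IndepSet G (A ∪ B \ closedNbhd G A) := by
    rintro u (hu | hu) v (hv | hv) h
    · exact hAi hu hv h
    · exact hv.2 (Or.inl ⟨u, hu, h.symm⟩)
    · exact hu.2 (Or.inl ⟨v, hv, h⟩)
    · exact hBi hu.1 hv.1 h
  have hnbhd : nbhd G (A ∪ B \ closedNbhd G A) ⊆ nbhd G A ∪ nbhd G B \ closedNbhd G A := by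
    rintro v ⟨x, hx | hx, h⟩
    · exact Or.inl ⟨x, hx, h⟩
    · by_cases hv : v ∈ nbhd G A
      · exact Or.inl hv
      · refine Or.inr ⟨⟨x, hx.1, h⟩, ?_⟩
        rintro (hv' | hv')
        · exact hv hv'
        · exact hx.2 (Or.inl ⟨v, hv', h.symm⟩)
  have hcard : (A ∪ B \ closedNbhd G A).ncard = A.ncard + (B \ closedNbhd G A).ncard :=
    Set.ncard_union_eq (Set.disjoint_left.2 fun v hv hv' => hv'.2 (Or.inr hv))
  have hcrit : IsCritical G (A ∪ B \ closedNbhd G A) := by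
    have h₁ := diffd_le_critDiff G (A ∪ B \ closedNbhd G A)
    have h₂ := (Set.ncard_le_ncard hnbhd).trans (Set.ncard_union_le _ _)
    simp only [IsCritical, diffd] at hAc h₁ ⊢
    omega
  have hmax := hAmax _ hindep hcrit
  have hB0 : B \ closedNbhd G A = ∅ := (Set.ncard_eq_zero).1 (by omega)
  have hN0 : nbhd G B \ closedNbhd G A = ∅ := (Set.ncard_eq_zero).1 (by omega)
  exact Set.union_subset (Set.sdiff_eq_empty.1 hN0) (Set.sdiff_eq_empty.1 hB0)

theorem nucleus_subset_diadem_diff_nbhd {V : Type*} [Finite V] (G : SimpleGraph V) :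
    nucleus G ⊆ diadem G \ nbhd G (diadem G) := by
  intro v hv
  obtain ⟨A, hA⟩ := maxCritIndepFam_nonempty G
  refine ⟨⟨A, hA, hv A hA⟩, ?_⟩
  rintro ⟨w, ⟨B, hB, hw⟩, h⟩
  exact hB.1 (hv B hB) hw h

theorem closedNbhd_diadem_subset {V : Type*} [Finite V] {G : SimpleGraph V} {A : Set V}
    (hA : A ∈ maxCritIndepFam G) : closedNbhd G (diadem G) ⊆ closedNbhd G A := by
  rintro v (⟨x, ⟨B, hB, hx⟩, h⟩ | ⟨B, hB, hv⟩)
  · exact closedNbhd_subset_of_mem_maxCritIndepFam hA hB (Or.inl ⟨x, hx, h⟩)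
  · exact closedNbhd_subset_of_mem_maxCritIndepFam hA hB (Or.inr hv)

/-- For every finite simple graph `G`,
`|nucleus(G)| + |diadem(G)| ≤ 2α(G)`. -/
theorem stmt3 {V : Type*} [Fintype V] (G : SimpleGraph V) :
    (nucleus G).ncard + (diadem G).ncard ≤ 2 * indNum G := by
  obtain ⟨A, hA⟩ := maxCritIndepFam_nonempty G
  have h₁ := Set.ncard_le_ncard (nucleus_subset_diadem_diff_nbhd G)
  have h₂ := Set.ncard_le_ncard (closedNbhd_diadem_subset hA)
  have h₃ := diffd_le_critDiff G (diadem G)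
  have h₄ := Set.ncard_sdiff_add_ncard (diadem G) (nbhd G (diadem G))
  have h₅ : (closedNbhd G A).ncard = (nbhd G A).ncard + A.ncard :=
    Set.ncard_union_eq hA.1.disjoint_nbhd
  have h₆ := hA.1.ncard_le_indNum
  have hAc := hA.2.1
  rw [Set.union_comm] at h₄
  simp only [IsCritical, diffd, closedNbhd] at hAc h₂ h₃ h₅
  omega
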